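/- Let λ1, λ2, μ1, μ2, μ3 > 0 with ρ1 = λ1/μ1 < 1 and ρ1 + ρ2 < 1 where ρ2 = λ2/μ2, let N ≥ 1 be an integer, and let P be a real number. Suppose Q2, Q3 : (0,1) → ℝ have limits Q2(1) := lim_{y→1⁻} Q2(y) and Q3(1) := lim_{y→1⁻} Q3(y), that Q1 : (0,1)×(0,1) → ℝ satisfies, for all x, y ∈ (0,1) with x·K(x,y) ≠ 0: x·K(x,y)·Q1(x,y) = λ1·(x−α(y))·(y·Q2(y)+Q3(y)) − μ3·(1−ρ1−ρ2)·( x·L1(x,y) − Λ(y) )·P, and that for every y ∈ (0,1): (A(y) − λ1·α(y)·y)·Q2(y) + (λ1(1−α(y)) + λ2(1−y))·Q3(y) = μ3·{ (ρ1+ρ2)·L3(y) − (1−ρ1−ρ2)·[ y·L2(y) + Λ(y) ] }·P. Then the iterated limit S := lim_{x→1⁻} lim_{y→1⁻} Q1(x,y) exists, and (1−ρ1−ρ2)·[ S + Q2(1) + Q3(1) ] − Q3(1) = −( (μ3/μ1)·ρ1 + (μ3/μ2)·ρ2 )·P. -/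

import Mathlib

open Real Filter Topology Set

noncomputable section

/-- The kernel discriminant Δ(y) = (λ+μ1−λ2·y)² − 4λ1μ1 with λ = λ1+λ2. -/
def Delta (l1 l2 m1 y : ℝ) : ℝ := (l1 + l2 + m1 - l2 * y) ^ 2 - 4 * l1 * m1

/-- The small kernel root α(y) = x1(y). -/
def alphaf (l1 l2 m1 y : ℝ) : ℝ :=
  (l1 + l2 + m1 - l2 * y - Real.sqrt (Delta l1 l2 m1 y)) / (2 * l1)

/-- The large kernel root x2(y). -/
def x2f (l1 l2 m1 y : ℝ) : ℝ :=
  (l1 + l2 + m1 - l2 * y + Real.sqrt (Delta l1 l2 m1 y)) / (2 * l1)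

/-- The kernel K(x,y) = λ1(1−x) + λ2(1−y) + μ1(1−1/x). -/
def Kker (l1 l2 m1 x y : ℝ) : ℝ :=
  l1 * (1 - x) + l2 * (1 - y) + m1 * (1 - 1 / x)

/-- A(y) = y·a(y) = λ1·y + λ2·y(1−y) + μ2·(y−1). -/
def Afun (l1 l2 m2 y : ℝ) : ℝ := l1 * y + l2 * y * (1 - y) + m2 * (y - 1)

/-- β(y) = H(y)/H(1) where H(y) = Σ_{k<N} (r2·y)^k and r2 = λ2/(λ1+λ2). -/
def betaf (l1 l2 : ℝ) (N : ℕ) (y : ℝ) : ℝ :=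
  (∑ k ∈ Finset.range N, (l2 / (l1 + l2) * y) ^ k) /
    (∑ k ∈ Finset.range N, (l2 / (l1 + l2) * 1) ^ k)

/-- L3(y) = β(y)(1−ρ1−ρ2). -/
def L3f (l1 l2 m1 m2 : ℝ) (N : ℕ) (y : ℝ) : ℝ :=
  betaf l1 l2 N y * (1 - l1 / m1 - l2 / m2)

/-- L2(y) = [λ1(α(y)−1)+λ2(y−1)]·L3(y)/(A(y)−λ1·y·α(y)). -/
def L2f (l1 l2 m1 m2 : ℝ) (N : ℕ) (y : ℝ) : ℝ :=
  (l1 * (alphaf l1 l2 m1 y - 1) + l2 * (y - 1)) * L3f l1 l2 m1 m2 N y /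
    (Afun l1 l2 m2 y - l1 * y * alphaf l1 l2 m1 y)

/-- L1(x,y) = λ1μ2(x−α(y))(y−1)·L3(y)/(x·K(x,y)·(A(y)−λ1·y·α(y))). -/
def L1f (l1 l2 m1 m2 : ℝ) (N : ℕ) (x y : ℝ) : ℝ :=
  l1 * m2 * (x - alphaf l1 l2 m1 y) * (y - 1) * L3f l1 l2 m1 m2 N y /
    (x * Kker l1 l2 m1 x y * (Afun l1 l2 m2 y - l1 * y * alphaf l1 l2 m1 y))

/-- Λ(y) = α(y)·(y·L2(y)+L3(y))/(x2(y)−x1(y)). -/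
def Lamf (l1 l2 m1 m2 : ℝ) (N : ℕ) (y : ℝ) : ℝ :=
  alphaf l1 l2 m1 y * (y * L2f l1 l2 m1 m2 N y + L3f l1 l2 m1 m2 N y) /
    (x2f l1 l2 m1 y - alphaf l1 l2 m1 y)

/-- b1 = λ2/(λ2+(√μ1−√λ1)²). -/
def b1v (l1 l2 m1 : ℝ) : ℝ := l2 / (l2 + (Real.sqrt m1 - Real.sqrt l1) ^ 2)

/-- b2 = λ2/(λ2+(√μ1+√λ1)²). -/
def b2v (l1 l2 m1 : ℝ) : ℝ := l2 / (l2 + (Real.sqrt m1 + Real.sqrt l1) ^ 2)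

/-- F(y) = λ2·y² − (1−2μ1+μ2)·y + 2μ2. -/
def Ff (l2 m1 m2 y : ℝ) : ℝ := l2 * y ^ 2 - (1 - 2 * m1 + m2) * y + 2 * m2

/-- T*(y) = F(y) + y·√Δ(y). -/
def Tstar (l1 l2 m1 m2 y : ℝ) : ℝ :=
  Ff l2 m1 m2 y + y * Real.sqrt (Delta l1 l2 m1 y)

/-- T(y) = F(y) − y·√Δ(y). -/
def Tm (l1 l2 m1 m2 y : ℝ) : ℝ :=
  Ff l2 m1 m2 y - y * Real.sqrt (Delta l1 l2 m1 y)

/-- η1 = ((1−2μ1) + √((1−2μ1)²+4(μ1−μ2)λ2))/(2μ2). -/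
def eta1 (l2 m1 m2 : ℝ) : ℝ :=
  (1 - 2 * m1 + Real.sqrt ((1 - 2 * m1) ^ 2 + 4 * (m1 - m2) * l2)) / (2 * m2)

/-- η2 = ((1−2μ1) − √((1−2μ1)²+4(μ1−μ2)λ2))/(2μ2). -/
def eta2 (l2 m1 m2 : ℝ) : ℝ :=
  (1 - 2 * m1 - Real.sqrt ((1 - 2 * m1) ^ 2 + 4 * (m1 - m2) * l2)) / (2 * m2)

/-- a = ((1−ρ1−ρ2)/(2μ2))·η1/(η1−η2). -/
def av (l1 l2 m1 m2 : ℝ) : ℝ :=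
  (1 - l1 / m1 - l2 / m2) / (2 * m2) * (eta1 l2 m1 m2 / (eta1 l2 m1 m2 - eta2 l2 m1 m2))

/-- b = ((1−ρ1−ρ2)/(2μ2))·η2/(η2−η1). -/
def bv (l1 l2 m1 m2 : ℝ) : ℝ :=
  (1 - l1 / m1 - l2 / m2) / (2 * m2) * (eta2 l2 m1 m2 / (eta2 l2 m1 m2 - eta1 l2 m1 m2))

/-- ι(y) = (μ1−λ+λ2y−√Δ(y))/(2μ2(y−1)). -/
def iotaf (l1 l2 m1 m2 y : ℝ) : ℝ :=
  (m1 - (l1 + l2) + l2 * y - Real.sqrt (Delta l1 l2 m1 y)) / (2 * m2 * (y - 1))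

/-- κ(y) = (2μ2(1−y) − (1−μ1y)·T(y))/(2μ1μ2·y(1−y)(1−ρ̄1·y)). -/
def kappaf (l1 l2 m1 m2 y : ℝ) : ℝ :=
  (2 * m2 * (1 - y) - (1 - m1 * y) * Tm l1 l2 m1 m2 y) /
    (2 * m1 * m2 * y * (1 - y) * (1 - (l1 + l2) / m1 * y))

/-- c0 = ((λ+μ1) − √((λ+μ1)² − 4λ1μ1))/(2μ1). -/
def c0v (l1 l2 m1 : ℝ) : ℝ :=
  (l1 + l2 + m1 - Real.sqrt ((l1 + l2 + m1) ^ 2 - 4 * l1 * m1)) / (2 * m1)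

/-- c1 = λ2·c0/√((λ+μ1)² − 4λ1μ1). -/
def c1v (l1 l2 m1 : ℝ) : ℝ :=
  l2 * c0v l1 l2 m1 / Real.sqrt ((l1 + l2 + m1) ^ 2 - 4 * l1 * m1)

/-- D = (λ+μ1−2√(λ1μ1))(μ1−μ2−√(λ1μ1)) + λ2μ2. -/
def Dv (l1 l2 m1 m2 : ℝ) : ℝ :=
  (l1 + l2 + m1 - 2 * Real.sqrt (l1 * m1)) * (m1 - m2 - Real.sqrt (l1 * m1)) + l2 * m2

/-- K(η) = λ2·b1·√(1 − b2/b1)/(2·√(b1·b2)·(η − b1)). -/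
def Kcv (l1 l2 m1 η : ℝ) : ℝ :=
  l2 * b1v l1 l2 m1 * Real.sqrt (1 - b2v l1 l2 m1 / b1v l1 l2 m1) /
    (2 * Real.sqrt (b1v l1 l2 m1 * b2v l1 l2 m1) * (η - b1v l1 l2 m1))

/-- σ(η) = K(η)/(b1·√π). -/
def sigmav (l1 l2 m1 η : ℝ) : ℝ :=
  Kcv l1 l2 m1 η / (b1v l1 l2 m1 * Real.sqrt Real.pi)

/-- K1(η). -/
def K1v (l1 l2 m1 m2 η : ℝ) : ℝ :=
  l2 * b1v l1 l2 m1 * Real.sqrt (1 - b2v l1 l2 m1 / b1v l1 l2 m1) *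
      ((1 - m1 / b1v l1 l2 m1) * (Ff l2 m1 m2 (1 / b1v l1 l2 m1) + 1)
        - 2 * m2 * (1 - 1 / b1v l1 l2 m1)) /
    (4 * m1 * m2 * Real.sqrt (b1v l1 l2 m1 * b2v l1 l2 m1) * (1 - η / b1v l1 l2 m1) *
      (1 - 1 / b1v l1 l2 m1) * (1 - (l1 + l2) / m1 / b1v l1 l2 m1))

/-- σ1(η) = K1(η)/(b1·√π). -/
def sigma1v (l1 l2 m1 m2 η : ℝ) : ℝ :=
  K1v l1 l2 m1 m2 η / (b1v l1 l2 m1 * Real.sqrt Real.pi)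

lemma alphaf_quadratic {l1 l2 m1 y : ℝ} (hl1 : l1 ≠ 0) (hD : 0 ≤ Delta l1 l2 m1 y) :
    l2 * (1 - y) * alphaf l1 l2 m1 y
      = (1 - alphaf l1 l2 m1 y) * (m1 - l1 * alphaf l1 l2 m1 y) := by
  have hs := Real.sq_sqrt hD
  unfold alphaf
  set s := Real.sqrt (Delta l1 l2 m1 y)
  unfold Delta at hs
  field_simp
  linear_combination -hs

lemma x2f_mul_alphaf {l1 l2 m1 y : ℝ} (hl1 : l1 ≠ 0) (hD : 0 ≤ Delta l1 l2 m1 y) :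
    l1 * x2f l1 l2 m1 y * alphaf l1 l2 m1 y = m1 := by
  have hs := Real.sq_sqrt hD
  unfold alphaf x2f
  set s := Real.sqrt (Delta l1 l2 m1 y)
  unfold Delta at hs
  field_simp
  linear_combination -hs

lemma Delta_one (l1 l2 m1 : ℝ) : Delta l1 l2 m1 1 = (m1 - l1) ^ 2 := by
  unfold Delta; ring

lemma alphaf_one {l1 m1 : ℝ} (l2 : ℝ) (hl1 : l1 ≠ 0) (h : l1 ≤ m1) : alphaf l1 l2 m1 1 = 1 := by
  rw [alphaf, Delta_one, Real.sqrt_sq (sub_nonneg.2 h)]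
  field_simp
  ring

lemma continuous_alphaf (l1 l2 m1 : ℝ) : Continuous (alphaf l1 l2 m1) := by
  unfold alphaf Delta
  fun_prop

lemma continuous_betaf (l1 l2 : ℝ) (N : ℕ) : Continuous (betaf l1 l2 N) := by
  unfold betaf
  fun_prop

lemma betaf_one {l1 l2 : ℝ} (hl1 : 0 < l1) (hl2 : 0 < l2) {N : ℕ} (hN : 1 ≤ N) :
    betaf l1 l2 N 1 = 1 := by
  refine div_self (ne_of_gt (Finset.sum_pos (fun k _ => by positivity) ?_))
  exact Finset.nonempty_range_iff.2 (by omega)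

/-- The factor left in `λ1·y·α(y) − A(y)` after removing `(1 − α(y)) / (λ2·α(y))`. -/
def reducedDenom (l1 l2 m1 m2 y : ℝ) : ℝ :=
  m2 * (m1 - l1 * alphaf l1 l2 m1 y) - l2 * m1 * y

lemma continuous_reducedDenom (l1 l2 m1 m2 : ℝ) : Continuous (reducedDenom l1 l2 m1 m2) := by
  have := continuous_alphaf l1 l2 m1
  unfold reducedDenom
  fun_prop

section Reduction

variable {l1 l2 m1 m2 y : ℝ}

lemma alphaf_drift (hl1 : l1 ≠ 0) (hD : 0 ≤ Delta l1 l2 m1 y) (ha : alphaf l1 l2 m1 y ≠ 0) :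
    l1 * (1 - alphaf l1 l2 m1 y) + l2 * (1 - y)
      = (1 - alphaf l1 l2 m1 y) * m1 / alphaf l1 l2 m1 y := by
  have hq := alphaf_quadratic hl1 hD
  field_simp
  linear_combination hq

lemma Afun_sub (hl1 : l1 ≠ 0) (hl2 : l2 ≠ 0) (hD : 0 ≤ Delta l1 l2 m1 y)
    (ha : alphaf l1 l2 m1 y ≠ 0) :
    Afun l1 l2 m2 y - l1 * y * alphaf l1 l2 m1 y
      = -((1 - alphaf l1 l2 m1 y) * reducedDenom l1 l2 m1 m2 y) / (l2 * alphaf l1 l2 m1 y) := by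
  have hq := alphaf_quadratic hl1 hD
  unfold Afun reducedDenom
  field_simp
  linear_combination (l2 * y - m2) * hq

lemma one_sub_alphaf_ne_zero (hl1 : l1 ≠ 0) (hl2 : l2 ≠ 0) (hD : 0 ≤ Delta l1 l2 m1 y)
    (ha : alphaf l1 l2 m1 y ≠ 0) (hy : y ≠ 1) : 1 - alphaf l1 l2 m1 y ≠ 0 := by
  intro h
  have hq := alphaf_quadratic hl1 hD
  rw [h, zero_mul] at hq
  exact mul_ne_zero (mul_ne_zero hl2 (sub_ne_zero.2 hy.symm)) ha hq

variable (N : ℕ)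

lemma L2f_eq (hl1 : l1 ≠ 0) (hl2 : l2 ≠ 0) (hD : 0 ≤ Delta l1 l2 m1 y)
    (ha : alphaf l1 l2 m1 y ≠ 0) (hy : y ≠ 1) (hE : reducedDenom l1 l2 m1 m2 y ≠ 0) :
    L2f l1 l2 m1 m2 N y = m1 * l2 * L3f l1 l2 m1 m2 N y / reducedDenom l1 l2 m1 m2 y := by
  have h1 := one_sub_alphaf_ne_zero hl1 hl2 hD ha hy
  have h2 := alphaf_drift hl1 hD ha
  have h3 : l1 * (alphaf l1 l2 m1 y - 1) + l2 * (y - 1)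
      = -((1 - alphaf l1 l2 m1 y) * m1 / alphaf l1 l2 m1 y) := by linear_combination -h2
  rw [L2f, Afun_sub hl1 hl2 hD ha, h3]
  field_simp

lemma Lamf_eq (hl1 : l1 ≠ 0) (hl2 : l2 ≠ 0) (hD : 0 ≤ Delta l1 l2 m1 y)
    (ha : alphaf l1 l2 m1 y ≠ 0) (hy : y ≠ 1) (hE : reducedDenom l1 l2 m1 m2 y ≠ 0) :
    Lamf l1 l2 m1 m2 N y
      = l1 * alphaf l1 l2 m1 y ^ 2 * m2 * (m1 - l1 * alphaf l1 l2 m1 y) * L3f l1 l2 m1 m2 N y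
        / (reducedDenom l1 l2 m1 m2 y * (m1 - l1 * alphaf l1 l2 m1 y ^ 2)) := by
  have hx : x2f l1 l2 m1 y - alphaf l1 l2 m1 y
      = (m1 - l1 * alphaf l1 l2 m1 y ^ 2) / (l1 * alphaf l1 l2 m1 y) := by
    field_simp
    linear_combination x2f_mul_alphaf hl1 hD
  rw [Lamf, L2f_eq N hl1 hl2 hD ha hy hE, hx]
  field_simp
  unfold reducedDenom
  ring

lemma L1f_eq (x : ℝ) (hl1 : l1 ≠ 0) (hl2 : l2 ≠ 0) (hD : 0 ≤ Delta l1 l2 m1 y)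
    (ha : alphaf l1 l2 m1 y ≠ 0) (hy : y ≠ 1) (hE : reducedDenom l1 l2 m1 m2 y ≠ 0)
    (hK : x * Kker l1 l2 m1 x y ≠ 0) :
    L1f l1 l2 m1 m2 N x y
      = l1 * m2 * (x - alphaf l1 l2 m1 y) * (m1 - l1 * alphaf l1 l2 m1 y) * L3f l1 l2 m1 m2 N y
        / (x * Kker l1 l2 m1 x y * reducedDenom l1 l2 m1 m2 y) := by
  have h1 := one_sub_alphaf_ne_zero hl1 hl2 hD ha hy
  have hy' : y - 1
      = -((1 - alphaf l1 l2 m1 y) * (m1 - l1 * alphaf l1 l2 m1 y)) / (l2 * alphaf l1 l2 m1 y) := by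
    field_simp
    linear_combination -alphaf_quadratic hl1 hD
  rw [L1f, Afun_sub hl1 hl2 hD ha, hy']
  generalize x * Kker l1 l2 m1 x y = k at *
  field_simp

/-- The right-hand side of the boundary equation vanishes at `y = 1` to the order of
`1 − α(y)`. -/
lemma boundary_rhs_eq (hl1 : l1 ≠ 0) (hl2 : l2 ≠ 0) (hm1 : m1 ≠ 0) (hm2 : m2 ≠ 0)
    (hD : 0 ≤ Delta l1 l2 m1 y)
    (ha : alphaf l1 l2 m1 y ≠ 0) (hy : y ≠ 1) (hE : reducedDenom l1 l2 m1 m2 y ≠ 0)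
    (hs : m1 - l1 * alphaf l1 l2 m1 y ^ 2 ≠ 0) :
    (l1 / m1 + l2 / m2) * L3f l1 l2 m1 m2 N y
        - (1 - l1 / m1 - l2 / m2) * (y * L2f l1 l2 m1 m2 N y + Lamf l1 l2 m1 m2 N y)
      = (1 - alphaf l1 l2 m1 y) * (L3f l1 l2 m1 m2 N y
        * ((m1 * m2 - l1 * m2 - l2 * m1) * l1 * alphaf l1 l2 m1 y
          + (l1 * m2 + m1 * (m1 - l1 * alphaf l1 l2 m1 y) / alphaf l1 l2 m1 y)
            * (m1 - l1 * alphaf l1 l2 m1 y ^ 2))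
        / (reducedDenom l1 l2 m1 m2 y * (m1 - l1 * alphaf l1 l2 m1 y ^ 2))) := by
  have hE' : reducedDenom l1 l2 m1 m2 y = (m1 * m2 - l1 * m2 - l2 * m1)
      + (1 - alphaf l1 l2 m1 y)
        * (l1 * m2 + m1 * (m1 - l1 * alphaf l1 l2 m1 y) / alphaf l1 l2 m1 y) := by
    unfold reducedDenom
    field_simp
    linear_combination m1 * alphaf_quadratic hl1 hD
  have hyE : y * (m1 * l2)
      = m2 * (m1 - l1 * alphaf l1 l2 m1 y) - reducedDenom l1 l2 m1 m2 y := by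
    unfold reducedDenom; ring
  have hL2 : y * L2f l1 l2 m1 m2 N y
      = (m2 * (m1 - l1 * alphaf l1 l2 m1 y) - reducedDenom l1 l2 m1 m2 y)
        * L3f l1 l2 m1 m2 N y / reducedDenom l1 l2 m1 m2 y := by
    rw [L2f_eq N hl1 hl2 hD ha hy hE, ← hyE]; ring
  rw [hL2, Lamf_eq N hl1 hl2 hD ha hy hE]
  generalize L3f l1 l2 m1 m2 N y = b at *
  generalize reducedDenom l1 l2 m1 m2 y = E at *
  generalize alphaf l1 l2 m1 y = t at *
  have hE'' : E * t = (m1 * m2 - l1 * m2 - l2 * m1) * t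
      + (1 - t) * (l1 * m2 * t + m1 * (m1 - l1 * t)) := by
    rw [hE']; field_simp
  clear hE' hL2 hyE
  field_simp
  linear_combination b * m1 * m2 * (m1 - l1 * t ^ 2) * hE''

end Reduction

/-- Proposition 1: the iterated limit of `Q1` exists and the first-order
generating functions satisfy the stated linear relation at `y = 1`. -/
theorem stmt6 (l1 l2 m1 m2 m3 : ℝ) (hl1 : 0 < l1) (hl2 : 0 < l2) (hm1 : 0 < m1)
    (hm2 : 0 < m2) (hm3 : 0 < m3)
    (hr1 : l1 / m1 < 1) (hr : l1 / m1 + l2 / m2 < 1)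
    (N : ℕ) (hN : 1 ≤ N) (P : ℝ)
    (Q1 : ℝ → ℝ → ℝ) (Q2 Q3 : ℝ → ℝ) (q2 q3 : ℝ)
    (hQ2 : Tendsto Q2 (𝓝[<] (1:ℝ)) (𝓝 q2))
    (hQ3 : Tendsto Q3 (𝓝[<] (1:ℝ)) (𝓝 q3))
    (hQ1 : ∀ x ∈ Ioo (0:ℝ) 1, ∀ y ∈ Ioo (0:ℝ) 1, x * Kker l1 l2 m1 x y ≠ 0 →
      x * Kker l1 l2 m1 x y * Q1 x y
        = l1 * (x - alphaf l1 l2 m1 y) * (y * Q2 y + Q3 y)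
          - m3 * (1 - l1 / m1 - l2 / m2)
            * (x * L1f l1 l2 m1 m2 N x y - Lamf l1 l2 m1 m2 N y) * P)
    (heq : ∀ y ∈ Ioo (0:ℝ) 1,
      (Afun l1 l2 m2 y - l1 * alphaf l1 l2 m1 y * y) * Q2 y
          + (l1 * (1 - alphaf l1 l2 m1 y) + l2 * (1 - y)) * Q3 y
        = m3 * ((l1 / m1 + l2 / m2) * L3f l1 l2 m1 m2 N y
            - (1 - l1 / m1 - l2 / m2)
              * (y * L2f l1 l2 m1 m2 N y + Lamf l1 l2 m1 m2 N y)) * P) :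
    ∃ S : ℝ, ∃ Q1l : ℝ → ℝ,
      (∀ x ∈ Ioo (0:ℝ) 1, Tendsto (fun y => Q1 x y) (𝓝[<] (1:ℝ)) (𝓝 (Q1l x))) ∧
      Tendsto Q1l (𝓝[<] (1:ℝ)) (𝓝 S) ∧
      (1 - l1 / m1 - l2 / m2) * (S + q2 + q3) - q3
        = -((m3 / m1) * (l1 / m1) + (m3 / m2) * (l2 / m2)) * P := by
  have hlm : l1 < m1 := (div_lt_one hm1).1 hr1
  have hl1' := hl1.ne'
  have hl2' := hl2.ne'
  have hm1' := hm1.ne'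
  have hm2' := hm2.ne'
  have hE1 : 0 < m1 * m2 - l1 * m2 - l2 * m1 := by
    rw [div_add_div _ _ hm1' hm2', div_lt_one (by positivity)] at hr
    linarith
  have hR : 1 - l1 / m1 - l2 / m2 = (m1 * m2 - l1 * m2 - l2 * m1) / (m1 * m2) := by
    field_simp
  have hw : m1 - l1 ≠ 0 := by linarith
  have ca := continuous_alphaf l1 l2 m1
  have cE := continuous_reducedDenom l1 l2 m1 m2
  have a1 := alphaf_one l2 hl1' hlm.le
  have E1 : reducedDenom l1 l2 m1 m2 1 = m1 * m2 - l1 * m2 - l2 * m1 := by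
    rw [reducedDenom, a1]; ring
  have b1 := betaf_one hl1 hl2 hN
  have hle : 𝓝[<] (1:ℝ) ≤ 𝓝 1 := nhdsWithin_le_nhds
  have ta : Tendsto (alphaf l1 l2 m1) (𝓝[<] 1) (𝓝 1) := by
    simpa only [a1] using (ca.tendsto 1).mono_left hle
  have tE : Tendsto (reducedDenom l1 l2 m1 m2) (𝓝[<] 1)
      (𝓝 (m1 * m2 - l1 * m2 - l2 * m1)) := by
    simpa only [E1] using (cE.tendsto 1).mono_left hle
  have tL3 : Tendsto (L3f l1 l2 m1 m2 N) (𝓝[<] 1) (𝓝 (1 - l1 / m1 - l2 / m2)) := by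
    have h := (((continuous_betaf l1 l2 N).tendsto 1).mono_left hle).mul_const
      (1 - l1 / m1 - l2 / m2)
    rwa [b1, one_mul] at h
  have ty : Tendsto (fun y : ℝ => y) (𝓝[<] 1) (𝓝 1) := hle
  have ts : Tendsto (fun y => m1 - l1 * alphaf l1 l2 m1 y ^ 2) (𝓝[<] 1) (𝓝 (m1 - l1)) := by
    simpa using (ta.pow 2).const_mul l1 |>.const_sub m1
  have tu : Tendsto (fun y => m1 - l1 * alphaf l1 l2 m1 y) (𝓝[<] 1) (𝓝 (m1 - l1)) := by
    simpa using ta.const_mul l1 |>.const_sub m1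
  have eD : ∀ᶠ y in 𝓝[<] (1:ℝ), 0 ≤ Delta l1 l2 m1 y := by
    have cD : Continuous (Delta l1 l2 m1) := by unfold Delta; fun_prop
    have h : 0 < Delta l1 l2 m1 1 := by rw [Delta_one]; positivity
    exact (((cD.tendsto 1).mono_left hle).eventually_const_lt h).mono fun _ => le_of_lt
  have ea := ta.eventually_ne one_ne_zero
  have eE := tE.eventually_ne hE1.ne'
  have es := ts.eventually_ne hw
  have ey : ∀ᶠ y in 𝓝[<] (1:ℝ), y ∈ Ioo (0:ℝ) 1 := Ioo_mem_nhdsLT one_pos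
  -- The boundary equation divided by `1 - α(y)`, in the limit.
  have key : -((m1 * m2 - l1 * m2 - l2 * m1) / (l2 * 1)) * q2 + m1 / 1 * q3
      = m3 * ((1 - l1 / m1 - l2 / m2)
        * ((m1 * m2 - l1 * m2 - l2 * m1) * l1 * 1 + (l1 * m2 + m1 * (m1 - l1) / 1) * (m1 - l1))
        / ((m1 * m2 - l1 * m2 - l2 * m1) * (m1 - l1))) * P := by
    refine tendsto_nhds_unique_of_eventuallyEq (l := 𝓝[<] (1:ℝ))
      ((((tE.div (ta.const_mul l2) (by simpa using hl2')).neg.mul hQ2).add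
        ((tendsto_const_nhds.div ta one_ne_zero).mul hQ3)))
      ((((tL3.mul ((ta.const_mul ((m1 * m2 - l1 * m2 - l2 * m1) * l1)).add
        ((((tu.const_mul m1).div ta one_ne_zero).const_add (l1 * m2)).mul ts))).div
        (tE.mul ts) (mul_ne_zero hE1.ne' hw)).const_mul m3).mul_const P) ?_
    filter_upwards [eD, ea, eE, es, ey] with y hD ha hE hs hy
    have hy1 : y ≠ 1 := hy.2.ne
    have h := heq y hy
    rw [boundary_rhs_eq N hl1' hl2' hm1' hm2' hD ha hy1 hE hs, mul_right_comm l1,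
      Afun_sub hl1' hl2' hD ha, alphaf_drift hl1' hD ha] at h
    refine mul_left_cancel₀ (one_sub_alphaf_ne_zero hl1' hl2' hD ha hy1) ?_
    simp only [Pi.div_apply]
    linear_combination h
  have hden : ∀ x ∈ Ioo (0:ℝ) 1, m1 - l1 * x ≠ 0 := fun x hx => by nlinarith [hx.2]
  refine ⟨l1 * (q2 + q3) / (m1 - l1 * 1)
      - m3 * (1 - l1 / m1 - l2 / m2) * P * l1 / (m1 - l1 * 1) ^ 2,
    fun x => l1 * (q2 + q3) / (m1 - l1 * x)
      - m3 * (1 - l1 / m1 - l2 / m2) * P * l1 / (m1 - l1 * x) ^ 2, ?_, ?_, ?_⟩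
  · intro x hx
    have hx0 : x ≠ 0 := hx.1.ne'
    have hx1 : 1 - x ≠ 0 := by linarith [hx.2]
    have hd := hden x hx
    have cK : Continuous fun y => x * Kker l1 l2 m1 x y := by unfold Kker; fun_prop
    have K1 : x * Kker l1 l2 m1 x 1 = (1 - x) * (l1 * x - m1) := by
      unfold Kker; field_simp; ring
    have hk : (1 - x) * (l1 * x - m1) ≠ 0 :=
      mul_ne_zero hx1 fun h => hd (by linarith)
    have tK : Tendsto (fun y => x * Kker l1 l2 m1 x y) (𝓝[<] 1)
        (𝓝 ((1 - x) * (l1 * x - m1))) := by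
      simpa only [K1] using (cK.tendsto 1).mono_left hle
    have eK := tK.eventually_ne hk
    have tL1 := ((((ta.const_sub x).const_mul (l1 * m2)).mul tu).mul tL3).div (tK.mul tE)
      (mul_ne_zero hk hE1.ne')
    have tLam := (((((ta.pow 2).const_mul l1).mul_const m2).mul tu).mul tL3).div (tE.mul ts)
      (mul_ne_zero hE1.ne' hw)
    have T := ((((ta.const_sub x).const_mul l1).mul ((ty.mul hQ2).add hQ3)).sub
      ((((tL1.const_mul x).sub tLam).const_mul (m3 * (1 - l1 / m1 - l2 / m2))).mul_const P)).div
      tK hk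
    have hlim := T.congr' (f₂ := fun y => Q1 x y) ?_
    · convert hlim using 2
      have hd' : l1 * x - m1 ≠ 0 := fun h => hd (by linarith)
      rw [hR]
      generalize m1 * m2 - l1 * m2 - l2 * m1 = e at *
      have hneg : l1 * x - m1 = -(m1 - l1 * x) := by ring
      rw [hneg]
      field_simp
      ring
    · filter_upwards [eD, ea, eE, es, ey, eK] with y hD ha hE hs hy hK
      have h := hQ1 x hx y hy hK
      rw [L1f_eq N x hl1' hl2' hD ha hy.2.ne hE hK, Lamf_eq N hl1' hl2' hD ha hy.2.ne hE] at h
      exact (eq_div_of_mul_eq hK ((mul_comm _ _).trans h)).symm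
  · refine ContinuousAt.tendsto (f := fun x => l1 * (q2 + q3) / (m1 - l1 * x)
      - m3 * (1 - l1 / m1 - l2 / m2) * P * l1 / (m1 - l1 * x) ^ 2) ?_ |>.mono_left hle
    have : m1 - l1 * 1 ≠ 0 := by rwa [mul_one]
    fun_prop (disch := first | assumption | positivity)
  · have hE1' := hE1.ne'
    rw [hR] at key ⊢
    simp only [mul_one, div_one] at key ⊢
    linear_combination (norm := skip) -(l2 / (m2 * (m1 - l1))) * key
    generalize he : m1 * m2 - l1 * m2 - l2 * m1 = e at hE1'
    field_simp
    rw [← he]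
    ring

end
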